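/- Fix p > 2 and define h(t,d) = ((1 − 2/p)(t + √(t²+d))² + d)(t + √(t²+d))^{p−2} on S = {(t,d) ∈ ℝ² : t ≥ 0, t² + d ≥ 0}, and let S' = {(t,d) ∈ S : h(t,d) ≥ 0}. Define h⁺ : [0,∞) × ℝ → [0,∞) by h⁺(t,d) = h(t,d) if (t,d) ∈ S' and h⁺(t,d) = 0 otherwise. Then h⁺ is a convex function on [0,∞) × ℝ. -/

import Mathlib

open Set

/-- `h(t,d) = ((1 - 2/p)(t + √(t²+d))² + d)(t + √(t²+d))^(p-2)`. -/
noncomputable def hfun (p : ℝ) (q : ℝ × ℝ) : ℝ :=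
  ((1 - 2 / p) * (q.1 + Real.sqrt (q.1 ^ 2 + q.2)) ^ 2 + q.2) *
    (q.1 + Real.sqrt (q.1 ^ 2 + q.2)) ^ (p - 2)

/-- `h⁺ = h` on `S' = {(t,d) : t ≥ 0, t² + d ≥ 0, h(t,d) ≥ 0}` and `h⁺ = 0` otherwise. -/
noncomputable def hplus (p : ℝ) (q : ℝ × ℝ) : ℝ :=
  if 0 ≤ q.1 ∧ 0 ≤ q.1 ^ 2 + q.2 ∧ 0 ≤ hfun p q then hfun p q else 0

/-- The affine function of `(t,d)` tangent to the graph of `hfun p` along the half-line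
`t + √(t²+d) = u`. -/
noncomputable def haffine (p u : ℝ) (q : ℝ × ℝ) : ℝ :=
  u ^ (p - 2) * ((p - 1) * q.2 + 2 * (p - 2) * u * q.1 - (p - 1) * (p - 2) / p * u ^ 2)

lemma haffine_combination {p u a b : ℝ} {x y : ℝ × ℝ} (hab : a + b = 1) :
    haffine p u (a • x + b • y) = a * haffine p u x + b * haffine p u y := by
  obtain rfl : b = 1 - a := by linarith
  simp only [haffine, Prod.fst_add, Prod.snd_add, Prod.smul_fst, Prod.smul_snd, smul_eq_mul]
  ring

lemma haffine_nonpos {p u : ℝ} {q : ℝ × ℝ} (hp : 2 < p) (hu : 0 ≤ u)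
    (hq : (p - 1) ^ 2 * q.2 + p * (p - 2) * q.1 ^ 2 ≤ 0) : haffine p u q ≤ 0 := by
  refine mul_nonpos_of_nonneg_of_nonpos (Real.rpow_nonneg hu _) ?_
  have hp1 : 0 < p * (p - 1) := by nlinarith
  have key : p * (p - 1) *
      ((p - 1) * q.2 + 2 * (p - 2) * u * q.1 - (p - 1) * (p - 2) / p * u ^ 2) =
      p * ((p - 1) ^ 2 * q.2 + p * (p - 2) * q.1 ^ 2)
        - (p - 2) * ((p - 1) * u - p * q.1) ^ 2 := by
    have : p ≠ 0 := by linarith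
    field_simp
    ring
  refine nonpos_of_mul_nonpos_right (a := p * (p - 1)) ?_ hp1
  rw [key]
  have h1 : p * ((p - 1) ^ 2 * q.2 + p * (p - 2) * q.1 ^ 2) ≤ 0 :=
    mul_nonpos_of_nonneg_of_nonpos (by linarith) hq
  have h2 : 0 ≤ (p - 2) * ((p - 1) * u - p * q.1) ^ 2 :=
    mul_nonneg (by linarith) (sq_nonneg _)
  linarith

lemma rpow_sub_two_mul_sq {p s : ℝ} (hp : 2 < p) (hs : 0 ≤ s) :
    s ^ (p - 2) * s ^ 2 = s ^ p := by
  rw [← Real.rpow_natCast s 2, ← Real.rpow_add_of_nonneg hs (by linarith) (by norm_num)]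
  norm_num

lemma mul_rpow_sub_two_mul_sq_le {p s u : ℝ} (hp : 2 < p) (hs : 0 ≤ s) (hu : 0 ≤ u) :
    p * (u ^ (p - 2) * s ^ 2) ≤ 2 * (s ^ (p - 2) * s ^ 2) + (p - 2) * (u ^ (p - 2) * u ^ 2) := by
  have hp0 : 0 < p := by linarith
  have h := Real.geom_mean_le_arith_mean2_weighted (w₁ := 2 / p) (w₂ := (p - 2) / p)
    (p₁ := s ^ p) (p₂ := u ^ p) (by positivity) (div_nonneg (by linarith) hp0.le)
    (Real.rpow_nonneg hs _) (Real.rpow_nonneg hu _) (by field_simp; ring)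
  rw [← Real.rpow_mul hs, ← Real.rpow_mul hu, mul_div_cancel₀ _ hp0.ne',
    mul_div_cancel₀ _ hp0.ne', Real.rpow_two] at h
  rw [rpow_sub_two_mul_sq hp hs, rpow_sub_two_mul_sq hp hu]
  calc p * (u ^ (p - 2) * s ^ 2) = p * (s ^ 2 * u ^ (p - 2)) := by ring
    _ ≤ p * (2 / p * s ^ p + (p - 2) / p * u ^ p) := by gcongr
    _ = 2 * s ^ p + (p - 2) * u ^ p := by field_simp

lemma hplus_nonneg (p : ℝ) (q : ℝ × ℝ) : 0 ≤ hplus p q := by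
  unfold hplus
  split_ifs with h
  exacts [h.2.2, le_rfl]

lemma snd_eq_of_nonneg {q : ℝ × ℝ} (hq : 0 ≤ q.1 ^ 2 + q.2) :
    q.2 = (q.1 + √(q.1 ^ 2 + q.2)) ^ 2 - 2 * q.1 * (q.1 + √(q.1 ^ 2 + q.2)) := by
  linear_combination -Real.sq_sqrt hq

lemma exists_hplus_eq_haffine {p : ℝ} (hp : 2 < p) (q : ℝ × ℝ) :
    ∃ u, 0 ≤ u ∧ hplus p q = haffine p u q := by
  unfold hplus
  split_ifs with h
  · refine ⟨q.1 + √(q.1 ^ 2 + q.2), add_nonneg h.1 (Real.sqrt_nonneg _), ?_⟩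
    have hd := snd_eq_of_nonneg h.2.1
    unfold hfun haffine
    set s := q.1 + √(q.1 ^ 2 + q.2)
    have : p ≠ 0 := by linarith
    rw [mul_comm, hd]
    congr 1
    field_simp
    ring
  · refine ⟨0, le_rfl, ?_⟩
    rw [haffine, Real.zero_rpow (by linarith), zero_mul]

lemma haffine_le_hfun {p u : ℝ} {q : ℝ × ℝ} (hp : 2 < p) (hu : 0 ≤ u) (ht : 0 ≤ q.1)
    (hq : 0 ≤ q.1 ^ 2 + q.2) (hs : 0 < q.1 + √(q.1 ^ 2 + q.2))
    (hle : p * q.1 ≤ (p - 1) * (q.1 + √(q.1 ^ 2 + q.2))) : haffine p u q ≤ hfun p q := by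
  have hd := snd_eq_of_nonneg hq
  have hp2 : 0 < p - 2 := by linarith
  have hp0 : 0 < p := by linarith
  unfold haffine hfun
  set s := q.1 + √(q.1 ^ 2 + q.2)
  have young := mul_rpow_sub_two_mul_sq_le hp hs.le hu
  have hP : 0 ≤ u ^ (p - 2) := Real.rpow_nonneg hu _
  set P := u ^ (p - 2)
  set R := s ^ (p - 2)
  rw [hd, ← sub_nonneg]
  have key : ((1 - 2 / p) * s ^ 2 + (s ^ 2 - 2 * q.1 * s)) * R -
      P * ((p - 1) * (s ^ 2 - 2 * q.1 * s) + 2 * (p - 2) * u * q.1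
        - (p - 1) * (p - 2) / p * u ^ 2) =
      ((p - 1) * s - p * q.1) / (p * s) *
        (2 * (R * s ^ 2) + (p - 2) * (P * u ^ 2) - p * (P * s ^ 2)) +
      q.1 / s * ((p - 2) * (P * (s - u) ^ 2)) := by
    have := hs.ne'
    field_simp
    ring
  rw [key]
  have h1 : 0 ≤ (p - 1) * s - p * q.1 := by linarith
  have h2 : 0 ≤ 2 * (R * s ^ 2) + (p - 2) * (P * u ^ 2) - p * (P * s ^ 2) := by linarith
  positivity

lemma haffine_le_hplus {p u : ℝ} {q : ℝ × ℝ} (hp : 2 < p) (ht : 0 ≤ q.1) (hu : 0 ≤ u) :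
    haffine p u q ≤ hplus p q := by
  rcases le_or_gt ((p - 1) ^ 2 * q.2 + p * (p - 2) * q.1 ^ 2) 0 with hc | hc
  · exact (haffine_nonpos hp hu hc).trans (hplus_nonneg p q)
  have hq : 0 ≤ q.1 ^ 2 + q.2 := by
    have h : 0 ≤ (p - 1) ^ 2 * (q.1 ^ 2 + q.2) := by nlinarith [sq_nonneg q.1]
    exact nonneg_of_mul_nonneg_right h (by nlinarith)
  have hr : q.1 ≤ (p - 1) * √(q.1 ^ 2 + q.2) := by
    refine le_of_sq_le_sq ?_ (mul_nonneg (by linarith) (Real.sqrt_nonneg _))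
    rw [mul_pow, Real.sq_sqrt hq]
    linarith
  have hs : 0 < q.1 + √(q.1 ^ 2 + q.2) := by
    refine lt_of_le_of_ne (add_nonneg ht (Real.sqrt_nonneg _)) fun h0 => ?_
    have hd := snd_eq_of_nonneg hq
    have hz : q.1 = 0 := by linarith [Real.sqrt_nonneg (q.1 ^ 2 + q.2)]
    rw [← h0] at hd
    simp [hd, hz] at hc
  have hle : p * q.1 ≤ (p - 1) * (q.1 + √(q.1 ^ 2 + q.2)) := by linarith
  have hnn : 0 ≤ hfun p q := by
    have h := haffine_le_hfun hp le_rfl ht hq hs hle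
    rwa [haffine, Real.zero_rpow (by linarith), zero_mul] at h
  rw [hplus, if_pos ⟨ht, hq, hnn⟩]
  exact haffine_le_hfun hp hu ht hq hs hle

/-- For `p > 2`, the function `h⁺` is convex on `[0,∞) × ℝ`. -/
theorem stmt_12 (p : ℝ) (hp : 2 < p) :
    ConvexOn ℝ (Set.Ici (0 : ℝ) ×ˢ (Set.univ : Set ℝ)) (hplus p) := by
  have hconv : Convex ℝ (Set.Ici (0 : ℝ) ×ˢ (Set.univ : Set ℝ)) :=
    (convex_Ici 0).prod convex_univ
  refine ⟨hconv, fun x hx y hy a b ha hb hab => ?_⟩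
  obtain ⟨u, hu, h⟩ := exists_hplus_eq_haffine hp (a • x + b • y)
  rw [h, haffine_combination hab]
  simp only [smul_eq_mul]
  gcongr
  · exact haffine_le_hplus hp hx.1 hu
  · exact haffine_le_hplus hp hy.1 hu
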